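/- Let J = [t₀, t₀ + a] with a > 0, let g : J → ℝ be nondecreasing, left-continuous and continuous, let f : J × ℝⁿ → ℝⁿ be continuous and satisfy conditions (A1) and (A2), and let h : J × ℝⁿ → ℝⁿ be continuously differentiable and satisfy condition (A3*). Let x : J → ℝⁿ be a solution of the hybrid measure differential equation on J with data (h, f, g, x₀), and assume that the matrix I − J_x h(t, x(t)) is invertible for every t ∈ J, where J_x h denotes the Jacobian matrix of h with respect to its second variable. Then: (c) if g is differentiable at t ∈ J, then x is differentiable at t and x′(t) = (I − J_x h(t, x(t)))⁻¹ ( ∂h/∂t (t, x(t)) + f(t, x(t)) g′(t) ); (d) if moreover g is differentiable on a neighborhood of t in J with derivative g′ continuous at t, then x is differentiable on that neighborhood and x′ is continuous at t. -/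

import Mathlib

open Set Filter Topology

namespace HMDEPaper

/-- `ℝⁿ` with the Euclidean norm. -/
abbrev En (n : ℕ) := EuclideanSpace ℝ (Fin n)

section Defs

variable {E : Type*} [NormedAddCommGroup E]

/-- `f` is regulated on the interval `[a, b]`: one-sided limits exist at every point. -/
def RegulatedOn (f : ℝ → E) (a b : ℝ) : Prop :=
  (∀ t ∈ Set.Ioc a b, ∃ L, Filter.Tendsto f (nhdsWithin t (Set.Ico a t)) (nhds L)) ∧
  (∀ t ∈ Set.Ico a b, ∃ L, Filter.Tendsto f (nhdsWithin t (Set.Ioc t b)) (nhds L))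

/-- `f` is regulated on `[0, ∞)`: one-sided limits exist at every point. -/
def RegulatedOnIci (f : ℝ → E) : Prop :=
  (∀ t : ℝ, 0 < t → ∃ L, Filter.Tendsto f (nhdsWithin t (Set.Ico 0 t)) (nhds L)) ∧
  (∀ t : ℝ, 0 ≤ t → ∃ L, Filter.Tendsto f (nhdsWithin t (Set.Ioi t)) (nhds L))

/-- A family `F` of functions is equiregulated on `[a, b]`. -/
def EquiregulatedOn (F : Set (ℝ → E)) (a b : ℝ) : Prop :=
  ∀ ε : ℝ, 0 < ε →
    (∀ τ ∈ Set.Ioc a b, ∃ δ > (0 : ℝ), ∀ y ∈ F, ∀ L,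
      Filter.Tendsto y (nhdsWithin τ (Set.Ico a τ)) (nhds L) →
      ∀ t ∈ Set.Ico a τ, τ - δ < t → ‖y t - L‖ < ε) ∧
    (∀ τ ∈ Set.Ico a b, ∃ δ > (0 : ℝ), ∀ y ∈ F, ∀ L,
      Filter.Tendsto y (nhdsWithin τ (Set.Ioc τ b)) (nhds L) →
      ∀ t ∈ Set.Ioc τ b, t < τ + δ → ‖y t - L‖ < ε)

/-- A D-function: continuous, nondecreasing on `[0, ∞)`, vanishing at `0`, positive on `(0, ∞)`. -/
def IsDFunction (φ : ℝ → ℝ) : Prop :=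
  ContinuousOn φ (Set.Ici 0) ∧ MonotoneOn φ (Set.Ici 0) ∧ φ 0 = 0 ∧
    ∀ s : ℝ, 0 < s → 0 < φ s

/-- `g` is left-continuous at every point of `(a, b]`. -/
def LeftContinuousOn (g : ℝ → ℝ) (a b : ℝ) : Prop :=
  ∀ t ∈ Set.Ioc a b, Filter.Tendsto g (nhdsWithin t (Set.Ico a t)) (nhds (g t))

/-- A bounded regulated function on `[0, ∞)` which is S-asymptotically `ω`-periodic. -/
def SAsympPeriodic (ω : ℝ) (x : ℝ → E) : Prop :=
  (∃ C : ℝ, ∀ t : ℝ, 0 ≤ t → ‖x t‖ ≤ C) ∧ RegulatedOnIci x ∧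
    Filter.Tendsto (fun t => x (t + ω) - x t) Filter.atTop (nhds 0)

end Defs

section KS

/-- A tagged partition of `[a, b]`. -/
structure TaggedPartition (a b : ℝ) where
  n : ℕ
  npos : 0 < n
  s : ℕ → ℝ
  τ : ℕ → ℝ
  s_first : s 0 = a
  s_last : s n = b
  s_mono : ∀ i < n, s i ≤ s (i + 1)
  tag_mem : ∀ i < n, τ i ∈ Set.Icc (s i) (s (i + 1))

/-- A tagged partition is `δ`-fine for a gauge `δ`. -/
def TaggedPartition.IsFine {a b : ℝ} (P : TaggedPartition a b) (δ : ℝ → ℝ) : Prop :=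
  ∀ i < P.n,
    Set.Icc (P.s i) (P.s (i + 1)) ⊆ Set.Ioo (P.τ i - δ (P.τ i)) (P.τ i + δ (P.τ i))

variable {E : Type*} [NormedAddCommGroup E] [NormedSpace ℝ E]

/-- The Kurzweil–Stieltjes Riemann sum of `f` w.r.t. `g` over a tagged partition. -/
def TaggedPartition.sum {a b : ℝ} (P : TaggedPartition a b) (f : ℝ → E) (g : ℝ → ℝ) : E :=
  ∑ i ∈ Finset.range P.n, (g (P.s (i + 1)) - g (P.s i)) • f (P.τ i)

/-- `I` is the Kurzweil–Stieltjes integral of `f` w.r.t. `g` over `[a, b]`. -/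
def HasKSIntegral (f : ℝ → E) (g : ℝ → ℝ) (a b : ℝ) (I : E) : Prop :=
  ∀ ε : ℝ, 0 < ε → ∃ δ : ℝ → ℝ, (∀ t, 0 < δ t) ∧
    ∀ P : TaggedPartition a b, P.IsFine δ → ‖P.sum f g - I‖ < ε

/-- `f` is Kurzweil–Stieltjes integrable w.r.t. `g` over `[a, b]`. -/
def KSIntegrable (f : ℝ → E) (g : ℝ → ℝ) (a b : ℝ) : Prop :=
  ∃ I, HasKSIntegral f g a b I

/-- A solution of the hybrid measure differential equation on `[t₀, t₀ + a]`
with data `(h, f, g, x₀)`. -/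
def IsHMDESolution (h f : ℝ → E → E) (g : ℝ → ℝ) (t₀ a : ℝ) (x₀ : E) (x : ℝ → E) : Prop :=
  RegulatedOn x t₀ (t₀ + a) ∧ x t₀ = x₀ ∧
  RegulatedOn (fun t => h t (x t)) t₀ (t₀ + a) ∧
  ∃ I : ℝ → E,
    (∀ t ∈ Set.Icc t₀ (t₀ + a), HasKSIntegral (fun s => f s (x s)) g t₀ t (I t)) ∧
    (∀ t ∈ Set.Icc t₀ (t₀ + a), x t = x₀ - h t₀ x₀ + h t (x t) + I t)

end KS

end HMDEPaper

namespace HMDEPaper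

section KurzweilStieltjes

variable {E : Type*} [NormedAddCommGroup E] [NormedSpace ℝ E]

namespace TaggedPartition

variable {a b c : ℝ}

lemma s_le_s (P : TaggedPartition a b) {i j : ℕ} (hij : i ≤ j) (hj : j ≤ P.n) :
    P.s i ≤ P.s j := by
  induction j, hij using Nat.le_induction with
  | base => exact le_rfl
  | succ k _ ih => exact (ih (by omega)).trans (P.s_mono k (by omega))

lemma s_mem_Icc (P : TaggedPartition a b) {i : ℕ} (hi : i ≤ P.n) : P.s i ∈ Icc a b :=
  ⟨P.s_first.ge.trans (P.s_le_s (Nat.zero_le i) hi), (P.s_le_s hi le_rfl).trans P.s_last.le⟩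

lemma tag_mem_Icc (P : TaggedPartition a b) {i : ℕ} (hi : i < P.n) : P.τ i ∈ Icc a b :=
  ⟨(P.s_mem_Icc hi.le).1.trans (P.tag_mem i hi).1,
    (P.tag_mem i hi).2.trans (P.s_mem_Icc (Nat.succ_le_of_lt hi)).2⟩

/-- The partition of `[a, b]` into a single interval with tag `τ`. -/
def single (τ : ℝ) (h : τ ∈ Icc a b) : TaggedPartition a b where
  n := 1
  npos := one_pos
  s i := if i = 0 then a else b
  τ _ := τ
  s_first := by simp
  s_last := by simp
  s_mono i hi := by
    obtain rfl : i = 0 := by omega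
    simpa using h.1.trans h.2
  tag_mem i hi := by
    obtain rfl : i = 0 := by omega
    simpa using h

lemma single_isFine {δ : ℝ → ℝ} (τ : ℝ) (h : τ ∈ Icc a b)
    (hδ : Icc a b ⊆ Ioo (τ - δ τ) (τ + δ τ)) : (single τ h).IsFine δ := by
  intro i hi
  obtain rfl : i = 0 := by simpa [single] using hi
  simpa [single] using hδ

/-- The concatenation of a partition of `[a, b]` and a partition of `[b, c]`. -/
def append (P : TaggedPartition a b) (Q : TaggedPartition b c) : TaggedPartition a c where
  n := P.n + Q.n
  npos := Nat.add_pos_left P.npos _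
  s i := if i < P.n then P.s i else Q.s (i - P.n)
  τ i := if i < P.n then P.τ i else Q.τ (i - P.n)
  s_first := by simp [P.npos, P.s_first]
  s_last := by simp [Q.s_last]
  s_mono i hi := by
    by_cases h₁ : i + 1 < P.n
    · simpa [h₁, show i < P.n by omega] using P.s_mono i (by omega)
    · by_cases h₂ : i < P.n
      · have : i + 1 = P.n := by omega
        simpa [h₂, this, Q.s_first, ← P.s_last] using P.s_mono i h₂
      · have : i + 1 - P.n = i - P.n + 1 := by omega
        simpa [h₁, h₂, this] using Q.s_mono (i - P.n) (by omega)
  tag_mem i hi := by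
    by_cases h₁ : i + 1 < P.n
    · simpa [h₁, show i < P.n by omega] using P.tag_mem i (by omega)
    · by_cases h₂ : i < P.n
      · have : i + 1 = P.n := by omega
        simpa [h₂, this, Q.s_first, ← P.s_last] using P.tag_mem i h₂
      · have : i + 1 - P.n = i - P.n + 1 := by omega
        simpa [h₁, h₂, this] using Q.tag_mem (i - P.n) (by omega)

section append

variable (P : TaggedPartition a b) (Q : TaggedPartition b c)

lemma append_s_left {i : ℕ} (hi : i ≤ P.n) : (P.append Q).s i = P.s i := by
  rcases hi.lt_or_eq with h | rfl
  · simp [append, h]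
  · simp [append, Q.s_first, P.s_last]

lemma append_s_right (i : ℕ) : (P.append Q).s (P.n + i) = Q.s i := by
  simp [append]

lemma append_tag_left {i : ℕ} (hi : i < P.n) : (P.append Q).τ i = P.τ i := by
  simp [append, hi]

lemma append_tag_right (i : ℕ) : (P.append Q).τ (P.n + i) = Q.τ i := by
  simp [append]

variable {P Q}

lemma IsFine.append {δ : ℝ → ℝ} (hP : P.IsFine δ) (hQ : Q.IsFine δ) :
    (P.append Q).IsFine δ := by
  intro i hi
  rcases lt_or_ge i P.n with h | h
  · rw [append_s_left _ _ h.le, append_s_left _ _ h, append_tag_left _ _ h]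
    exact hP i h
  · obtain ⟨j, rfl⟩ := Nat.exists_eq_add_of_le h
    rw [append_s_right, add_assoc, append_s_right, append_tag_right]
    exact hQ j (Nat.lt_of_add_lt_add_left hi)

variable (P Q) in
lemma sum_append (f : ℝ → E) (g : ℝ → ℝ) :
    (P.append Q).sum f g = P.sum f g + Q.sum f g := by
  unfold TaggedPartition.sum
  rw [show (P.append Q).n = P.n + Q.n from rfl, Finset.sum_range_add]
  congr 1
  · refine Finset.sum_congr rfl fun i hi => ?_
    have h := Finset.mem_range.1 hi
    rw [append_s_left _ _ h.le, append_s_left _ _ h, append_tag_left _ _ h]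
  · refine Finset.sum_congr rfl fun i _ => ?_
    rw [append_s_right, add_assoc, append_s_right, append_tag_right]

end append

lemma IsFine.mono {P : TaggedPartition a b} {δ δ' : ℝ → ℝ} (hP : P.IsFine δ)
    (h : ∀ t, δ t ≤ δ' t) : P.IsFine δ' := fun i hi =>
  (hP i hi).trans (Ioo_subset_Ioo (by linarith [h (P.τ i)]) (by linarith [h (P.τ i)]))

/-- Cousin's lemma. -/
lemma exists_isFine (hab : a ≤ b) {δ : ℝ → ℝ} (hδ : ∀ t, 0 < δ t) :
    ∃ P : TaggedPartition a b, P.IsFine δ := by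
  set T : Set ℝ := {r | r ∈ Icc a b ∧ ∃ P : TaggedPartition a r, P.IsFine δ}
  have haT : a ∈ T := by
    refine ⟨⟨le_rfl, hab⟩, single a ⟨le_rfl, le_rfl⟩, single_isFine _ _ ?_⟩
    rintro r ⟨h₁, h₂⟩
    constructor <;> linarith [hδ a]
  have hbdd : BddAbove T := ⟨b, fun r hr => hr.1.2⟩
  set m := sSup T
  have ham : a ≤ m := le_csSup hbdd haT
  have hmb : m ≤ b := csSup_le ⟨a, haT⟩ fun r hr => hr.1.2
  obtain ⟨r, ⟨hrmem, P, hP⟩, hr⟩ := exists_lt_of_lt_csSup ⟨a, haT⟩ (sub_lt_self m (hδ m))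
  have hrm : r ≤ m := le_csSup hbdd ⟨hrmem, P, hP⟩
  have key : ∀ q, m ≤ q → q < m + δ m → ∃ P : TaggedPartition a q, P.IsFine δ := by
    intro q hmq hq
    refine ⟨P.append (single m ⟨hrm, hmq⟩), hP.append (single_isFine _ _ ?_)⟩
    exact fun u hu => ⟨hr.trans_le hu.1, hu.2.trans_lt hq⟩
  rcases hmb.eq_or_lt with h | h
  · exact h ▸ key m le_rfl (by linarith [hδ m])
  · have hlt : m < min b (m + δ m / 2) := lt_min h (by linarith [hδ m])
    have hmem : min b (m + δ m / 2) ∈ T :=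
      ⟨⟨ham.trans hlt.le, min_le_left _ _⟩, key _ hlt.le
        ((min_le_right _ _).trans_lt (by linarith [hδ m]))⟩
    exact absurd (le_csSup hbdd hmem) hlt.not_ge

lemma norm_sum_sub_le (P : TaggedPartition a b) {f : ℝ → E} {g : ℝ → ℝ} {v : E} {K : ℝ}
    (hg : MonotoneOn g (Icc a b)) (hf : ∀ r ∈ Icc a b, ‖f r - v‖ ≤ K) :
    ‖P.sum f g - (g b - g a) • v‖ ≤ K * (g b - g a) := by
  have htel : g b - g a = ∑ i ∈ Finset.range P.n, (g (P.s (i + 1)) - g (P.s i)) := by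
    rw [Finset.sum_range_sub (fun i => g (P.s i)), P.s_last, P.s_first]
  rw [htel, Finset.sum_smul, Finset.mul_sum, TaggedPartition.sum, ← Finset.sum_sub_distrib]
  refine norm_sum_le_of_le _ fun i hi => ?_
  have hi := Finset.mem_range.1 hi
  have hnonneg : 0 ≤ g (P.s (i + 1)) - g (P.s i) :=
    sub_nonneg.2 (hg (P.s_mem_Icc hi.le) (P.s_mem_Icc hi) (P.s_mono i hi))
  rw [← smul_sub, norm_smul, Real.norm_of_nonneg hnonneg, mul_comm]
  exact mul_le_mul_of_nonneg_right (hf _ (P.tag_mem_Icc hi)) hnonneg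

end TaggedPartition

/-- Additivity of the Kurzweil–Stieltjes integral over adjacent intervals. -/
lemma HasKSIntegral.sub {f : ℝ → E} {g : ℝ → ℝ} {a b c : ℝ} {I₁ I₂ : E} (hab : a ≤ b)
    (h₁ : HasKSIntegral f g a b I₁) (h₂ : HasKSIntegral f g a c I₂) :
    HasKSIntegral f g b c (I₂ - I₁) := by
  intro ε hε
  obtain ⟨δ₁, hδ₁, H₁⟩ := h₁ (ε / 2) (half_pos hε)
  obtain ⟨δ₂, hδ₂, H₂⟩ := h₂ (ε / 2) (half_pos hε)
  refine ⟨fun t => min (δ₁ t) (δ₂ t), fun t => lt_min (hδ₁ t) (hδ₂ t), fun Q hQ => ?_⟩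
  obtain ⟨P, hP⟩ := TaggedPartition.exists_isFine hab (δ := fun t => min (δ₁ t) (δ₂ t))
    fun t => lt_min (hδ₁ t) (hδ₂ t)
  have e₁ := H₁ P (hP.mono fun t => min_le_left _ _)
  have e₂ := H₂ (P.append Q) ((hP.append hQ).mono fun t => min_le_right _ _)
  rw [TaggedPartition.sum_append] at e₂
  calc ‖Q.sum f g - (I₂ - I₁)‖
      = ‖(P.sum f g + Q.sum f g - I₂) - (P.sum f g - I₁)‖ := by congr 1; abel
    _ ≤ _ := norm_sub_le _ _
    _ < ε := by linarith

lemma HasKSIntegral.norm_sub_smul_le {f : ℝ → E} {g : ℝ → ℝ} {a b : ℝ} {I v : E} {K : ℝ}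
    (h : HasKSIntegral f g a b I) (hab : a ≤ b) (hg : MonotoneOn g (Icc a b))
    (hf : ∀ r ∈ Icc a b, ‖f r - v‖ ≤ K) :
    ‖I - (g b - g a) • v‖ ≤ K * (g b - g a) := by
  refine le_of_forall_pos_le_add fun ε hε => ?_
  obtain ⟨δ, hδ, H⟩ := h ε hε
  obtain ⟨P, hP⟩ := TaggedPartition.exists_isFine hab hδ
  have e₁ := H P hP
  have e₂ := P.norm_sum_sub_le hg hf
  calc ‖I - (g b - g a) • v‖
      = ‖(P.sum f g - (g b - g a) • v) - (P.sum f g - I)‖ := by congr 1; abel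
    _ ≤ _ := norm_sub_le _ _
    _ ≤ _ := by linarith

variable {f I : ℝ → E} {g : ℝ → ℝ} {a b : ℝ}

lemma norm_indefinite_sub_sub_smul_le (hg : MonotoneOn g (Icc a b))
    (hI : ∀ t ∈ Icc a b, HasKSIntegral f g a t (I t)) {s t : ℝ} (hs : s ∈ Icc a b)
    (ht : t ∈ Icc a b) {v : E} {K : ℝ} (hf : ∀ r ∈ uIcc t s, ‖f r - v‖ ≤ K) :
    ‖I s - I t - (g s - g t) • v‖ ≤ K * |g s - g t| := by
  rcases le_total t s with h | h
  · have hg' := hg.mono (Icc_subset_Icc ht.1 hs.2)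
    rw [abs_of_nonneg (sub_nonneg.2 (hg ht hs h))]
    exact ((hI t ht).sub ht.1 (hI s hs)).norm_sub_smul_le h hg' (by rwa [uIcc_of_le h] at hf)
  · have hg' := hg.mono (Icc_subset_Icc hs.1 ht.2)
    have hneg : I s - I t - (g s - g t) • v = -(I t - I s - (g t - g s) • v) := by module
    rw [abs_sub_comm, abs_of_nonneg (sub_nonneg.2 (hg hs ht h)), hneg, norm_neg]
    exact ((hI s hs).sub hs.1 (hI t ht)).norm_sub_smul_le h hg' (by rwa [uIcc_of_ge h] at hf)

lemma eventually_forall_uIcc {p : ℝ → Prop} {t : ℝ} (ht : t ∈ Icc a b)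
    (hp : ∀ᶠ s in 𝓝[Icc a b] t, p s) : ∀ᶠ s in 𝓝[Icc a b] t, ∀ r ∈ uIcc t s, p r := by
  have h : Tendsto (fun s => uIcc t s) (𝓝[Icc a b] t) (𝓝[Icc a b] t).smallSets :=
    Tendsto.uIcc (tendsto_const_nhdsWithin ht) tendsto_id
  exact h.eventually hp.smallSets

lemma continuousWithinAt_indefinite (hg : MonotoneOn g (Icc a b))
    (hI : ∀ t ∈ Icc a b, HasKSIntegral f g a t (I t)) {t : ℝ} (ht : t ∈ Icc a b)
    (hgt : ContinuousWithinAt g (Icc a b) t) {K : ℝ}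
    (hf : ∀ᶠ s in 𝓝[Icc a b] t, ‖f s‖ ≤ K) : ContinuousWithinAt I (Icc a b) t := by
  have hlim : Tendsto (fun s => K * |g s - g t|) (𝓝[Icc a b] t) (𝓝 0) := by
    simpa using ((hgt.sub_const (g t)).abs.const_mul K : Tendsto _ _ _)
  refine tendsto_iff_norm_sub_tendsto_zero.2 (squeeze_zero' (.of_forall fun _ => norm_nonneg _)
    ?_ hlim)
  filter_upwards [eventually_forall_uIcc ht hf, self_mem_nhdsWithin] with s hs hsJ
  simpa using norm_indefinite_sub_sub_smul_le hg hI hsJ ht (v := 0) (by simpa using hs)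

lemma hasDerivWithinAt_indefinite (hg : MonotoneOn g (Icc a b))
    (hI : ∀ t ∈ Icc a b, HasKSIntegral f g a t (I t)) {t d : ℝ} (ht : t ∈ Icc a b)
    (hgt : HasDerivWithinAt g d (Icc a b) t) (hf : ContinuousWithinAt f (Icc a b) t) :
    HasDerivWithinAt I (d • f t) (Icc a b) t := by
  have h₁ : (fun s => I s - I t - (g s - g t) • f t) =o[𝓝[Icc a b] t] fun s => g s - g t := by
    refine Asymptotics.isLittleO_iff.2 fun ε hε => ?_
    have hev : ∀ᶠ s in 𝓝[Icc a b] t, ‖f s - f t‖ ≤ ε := by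
      filter_upwards [hf (Metric.closedBall_mem_nhds (f t) hε)] with s hs
      simpa [dist_eq_norm] using hs
    filter_upwards [eventually_forall_uIcc ht hev, self_mem_nhdsWithin] with s hs hsJ
    exact norm_indefinite_sub_sub_smul_le hg hI hsJ ht hs
  have h₂ : (fun s => g s - g t) =O[𝓝[Icc a b] t] fun s => s - t :=
    hgt.hasFDerivWithinAt.isBigO_sub
  have h₃ := (hgt.smul_const (f t)).isLittleO
  refine .of_isLittleO (((h₁.trans_isBigO h₂).add h₃).congr_left fun s => ?_)
  module

end KurzweilStieltjes

namespace RegulatedOn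

variable {E F : Type*} [NormedAddCommGroup E] [NormedAddCommGroup F] {a b : ℝ}

lemma eventually_norm_le {x : ℝ → E} (hx : RegulatedOn x a b) {t : ℝ} (ht : t ∈ Icc a b) :
    ∃ K, ∀ᶠ s in 𝓝[Icc a b] t, ‖x s‖ ≤ K := by
  have hL : ∃ K, ∀ᶠ s in 𝓝[Ico a t] t, ‖x s‖ ≤ K := by
    rcases ht.1.eq_or_lt with rfl | h
    · simp
    · obtain ⟨L, hL⟩ := hx.1 t ⟨h, ht.2⟩
      exact ⟨‖L‖ + 1, hL.norm.eventually_le_const (lt_add_one _)⟩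
  have hR : ∃ K, ∀ᶠ s in 𝓝[Ioc t b] t, ‖x s‖ ≤ K := by
    rcases ht.2.eq_or_lt with rfl | h
    · simp
    · obtain ⟨L, hL⟩ := hx.2 t ⟨ht.1, h⟩
      exact ⟨‖L‖ + 1, hL.norm.eventually_le_const (lt_add_one _)⟩
  obtain ⟨K₁, h₁⟩ := hL
  obtain ⟨K₂, h₂⟩ := hR
  refine ⟨max ‖x t‖ (max K₁ K₂), ?_⟩
  rw [← Ico_union_Icc_eq_Icc ht.1 ht.2, ← Ioc_insert_left ht.2, nhdsWithin_union,
    nhdsWithin_insert, eventually_sup, eventually_sup, eventually_pure]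
  exact ⟨h₁.mono fun s hs => by simp [hs], by simp, h₂.mono fun s hs => by simp [hs]⟩

lemma comp_continuous {x : ℝ → E} (hx : RegulatedOn x a b) {f : ℝ → E → F}
    (hf : Continuous (Function.uncurry f)) : RegulatedOn (fun t => f t (x t)) a b := by
  have key : ∀ (t : ℝ) (u : Set ℝ) (L : E), Tendsto x (𝓝[u] t) (𝓝 L) →
      Tendsto (fun t => f t (x t)) (𝓝[u] t) (𝓝 (f t L)) := fun t u L hL =>
    (hf.tendsto (t, L)).comp ((tendsto_id.mono_left nhdsWithin_le_nhds).prodMk_nhds hL)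
  exact ⟨fun t ht => (hx.1 t ht).elim fun L hL => ⟨_, key t _ L hL⟩,
    fun t ht => (hx.2 t ht).elim fun L hL => ⟨_, key t _ L hL⟩⟩

/-- A regulated function is continuous at `t` as soon as its one-sided limits
at `t` can only be `x t`. -/
lemma continuousWithinAt_of_unique {x : ℝ → E} (hx : RegulatedOn x a b) {t : ℝ}
    (ht : t ∈ Icc a b)
    (h : ∀ L, ∀ u ⊆ Icc a b, (𝓝[u] t).NeBot → Tendsto x (𝓝[u] t) (𝓝 L) → L = x t) :
    ContinuousWithinAt x (Icc a b) t := by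
  have key : ∀ u ⊆ Icc a b, ((𝓝[u] t).NeBot → ∃ L, Tendsto x (𝓝[u] t) (𝓝 L)) →
      ContinuousWithinAt x u t := by
    intro u hu hlim
    rcases (𝓝[u] t).eq_or_neBot with hbot | hne
    · simp [ContinuousWithinAt, hbot]
    · obtain ⟨L, hL⟩ := hlim hne
      rw [ContinuousWithinAt, ← h L u hu hne hL]
      exact hL
  rw [← Ico_union_Icc_eq_Icc ht.1 ht.2, ← Ioc_insert_left ht.2]
  refine ContinuousWithinAt.union (key _ (Ico_subset_Icc_self.trans (Icc_subset_Icc_right ht.2))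
    fun hne => ?_) (ContinuousWithinAt.insert (key _ (Ioc_subset_Icc_self.trans
    (Icc_subset_Icc_left ht.1)) fun hne => ?_))
  · rcases ht.1.eq_or_lt with rfl | hlt
    · exact absurd hne (by simp)
    · exact hx.1 t ⟨hlt, ht.2⟩
  · rcases ht.2.eq_or_lt with rfl | hlt
    · exact absurd hne (by simp)
    · exact hx.2 t ⟨ht.1, hlt⟩

end RegulatedOn

/-- Differentiation of a continuous solution of `x r = c + H (r, x r) + I r`. -/
lemma hasDerivWithinAt_of_implicit {E : Type*} [NormedAddCommGroup E] [NormedSpace ℝ E]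
    {H : ℝ × E → E} {H' : ℝ × E →L[ℝ] E} {x I : ℝ → E} {c w : E} {u : Set ℝ} {t : ℝ}
    (hH : HasFDerivAt H H' (t, x t)) (hx : ContinuousWithinAt x u t)
    (hI : HasDerivWithinAt I w u t) (ht : t ∈ u)
    (heq : ∀ r ∈ u, x r = c + H (r, x r) + I r) (e : E ≃L[ℝ] E)
    (he : (e : E →L[ℝ] E) = .id ℝ E - H'.comp (.inr ℝ ℝ E)) :
    HasDerivWithinAt x (e.symm (H' (1, 0) + w)) u t := by
  set v := e.symm (H' (1, 0) + w) with hv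
  set y : ℝ → E := fun r => x r - x t - (r - t) • v with hy
  have hev : e v = H' (1, 0) + w := e.apply_symm_apply _
  have he' : ∀ z, e z = z - H' (0, z) := fun z => by
    simpa using congrArg (fun A : E →L[ℝ] E => A z) he
  have htend : Tendsto (fun r => (r, x r)) (𝓝[u] t) (𝓝 (t, x t)) :=
    (tendsto_id.mono_left nhdsWithin_le_nhds).prodMk_nhds hx
  have hpair : (fun r => (r, x r) - (t, x t)) =O[𝓝[u] t] fun r => ‖r - t‖ + ‖y r‖ := by
    refine Asymptotics.IsBigO.of_bound (1 + ‖v‖) (.of_forall fun r => ?_)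
    have hxr : x r - x t = y r + (r - t) • v := by simp [hy]
    have h₁ : ‖x r - x t‖ ≤ ‖y r‖ + ‖r - t‖ * ‖v‖ := by
      rw [hxr, ← norm_smul]; exact norm_add_le _ _
    rw [Real.norm_of_nonneg (by positivity), Prod.mk_sub_mk, Prod.norm_mk]
    refine max_le ?_ (h₁.trans ?_) <;>
      nlinarith [norm_nonneg v, norm_nonneg (y r), norm_nonneg (r - t),
        mul_nonneg (norm_nonneg v) (norm_nonneg (y r)),
        mul_nonneg (norm_nonneg v) (norm_nonneg (r - t))]
  have h₁ := (hH.isLittleO.comp_tendsto htend).trans_isBigO hpair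
  have h₂ : (fun r => I r - I t - (r - t) • w) =o[𝓝[u] t] fun r => ‖r - t‖ + ‖y r‖ := by
    refine hI.isLittleO.trans_isBigO (Asymptotics.IsBigO.of_bound 1 (.of_forall fun r => ?_))
    rw [Real.norm_of_nonneg (show 0 ≤ ‖r - t‖ + ‖y r‖ by positivity)]
    linarith [norm_nonneg (y r)]
  have h₃ : (fun r => e (y r)) =o[𝓝[u] t] fun r => ‖r - t‖ + ‖y r‖ := by
    refine (h₁.add h₂).congr' ?_ .rfl
    filter_upwards [self_mem_nhdsWithin] with r hr
    have hsplit : H' ((r, x r) - (t, x t)) = (r - t) • H' (1, 0) + H' (0, x r - x t) := by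
      rw [← map_smul, ← map_add]; simp
    have hd : x r - x t = H (r, x r) - H (t, x t) + (I r - I t) := by
      conv_lhs => rw [heq r hr, heq t ht]
      abel
    have hE : e (y r) = (x r - x t) - H' (0, x r - x t) - (r - t) • (H' (1, 0) + w) := by
      rw [hy, map_sub, map_smul, hev, he']
    simp only [Function.comp_apply]
    have hd' : H (r, x r) - H (t, x t) = x r - x t - (I r - I t) := by rw [hd]; abel
    rw [hE, hsplit, hd']
    module
  have h₄ : y =o[𝓝[u] t] fun r => ‖r - t‖ + ‖y r‖ :=
    (e.isBigO_comp_rev y _).trans_isLittleO h₃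
  refine .of_isLittleO (Asymptotics.isLittleO_iff.2 fun ε hε => ?_)
  have hε' : 0 < min (1 / 2) (ε / 2) := lt_min (by norm_num) (half_pos hε)
  filter_upwards [Asymptotics.isLittleO_iff.1 h₄ hε'] with r hr
  rw [Real.norm_of_nonneg (by positivity), mul_add] at hr
  have := mul_le_mul_of_nonneg_right (min_le_left (1 / 2) (ε / 2)) (norm_nonneg (y r))
  have := mul_le_mul_of_nonneg_right (min_le_right (1 / 2) (ε / 2)) (norm_nonneg (r - t))
  change ‖y r‖ ≤ ε * ‖r - t‖
  linarith

/-- Under a nonlinear contraction condition, a regulated solution of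
`x t = c + h t (x t) + I t` is continuous wherever `I` is. -/
lemma continuousWithinAt_of_regulatedOn_of_contraction {E : Type*} [NormedAddCommGroup E]
    {h : ℝ → E → E} {x I : ℝ → E} {c : E} {a b t : ℝ} {φ : ℝ → ℝ → ℝ}
    (hh : Continuous (Function.uncurry h))
    (hφ : ∀ r : ℝ, 0 ≤ r → ∀ s : ℝ, 0 < s → φ s r < s)
    (hlip : ∀ r : ℝ, 0 ≤ r → ∀ t ∈ Icc a b, ∀ u v : E,
      ‖u‖ ≤ r → ‖v‖ ≤ r → ‖h t u - h t v‖ ≤ φ ‖u - v‖ r)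
    (hx : RegulatedOn x a b) (ht : t ∈ Icc a b) (hI : ContinuousWithinAt I (Icc a b) t)
    (heq : ∀ s ∈ Icc a b, x s = c + h s (x s) + I s) :
    ContinuousWithinAt x (Icc a b) t := by
  refine hx.continuousWithinAt_of_unique ht fun L u hu hne hL => ?_
  have hlim : Tendsto (fun s => c + h s (x s) + I s) (𝓝[u] t) (𝓝 (c + h t L + I t)) :=
    (tendsto_const_nhds.add ((hh.tendsto (t, L)).comp
      ((tendsto_id.mono_left nhdsWithin_le_nhds).prodMk_nhds hL))).add (hI.mono hu)
  have hLeq : L = c + h t L + I t := by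
    refine tendsto_nhds_unique hL (hlim.congr' ?_)
    filter_upwards [self_mem_nhdsWithin] with s hs using (heq s (hu hs)).symm
  by_contra hLx
  have hsub : L - x t = h t L - h t (x t) := by
    conv_lhs => rw [hLeq, heq t ht]
    abel
  have hr : 0 ≤ max ‖L‖ ‖x t‖ := (norm_nonneg L).trans (le_max_left _ _)
  have h₁ := hlip _ hr t ht L (x t) (le_max_left _ _) (le_max_right _ _)
  rw [← hsub] at h₁
  exact (hφ _ hr _ (norm_pos_iff.2 (sub_ne_zero.2 hLx))).not_ge h₁

/-- Proposition 4.2, parts (c) and (d): the derivative of a solution at points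
of differentiability of `g`, and continuous differentiability. -/
theorem differentiability_of_solutions_formula
    {n : ℕ} (t₀ a : ℝ) (ha : 0 < a)
    (g : ℝ → ℝ) (hg_mono : MonotoneOn g (Set.Icc t₀ (t₀ + a)))
    (hg_lc : LeftContinuousOn g t₀ (t₀ + a))
    (hg_cont : ContinuousOn g (Set.Icc t₀ (t₀ + a)))
    (f h : ℝ → En n → En n)
    (hf_cont : Continuous (Function.uncurry f))
    (A1 : ∀ u : En n, KSIntegrable (fun s => f s u) g t₀ (t₀ + a))
    (M : ℝ → ℝ)
    (hM_nonneg : ∀ s ∈ Set.Icc t₀ (t₀ + a), 0 ≤ M s)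
    (hM_int : KSIntegrable M g t₀ (t₀ + a))
    (A2 : ∀ (u : En n) (c d : ℝ), t₀ ≤ c → c ≤ d → d ≤ t₀ + a →
      ∀ (If : En n) (Im : ℝ), HasKSIntegral (fun s => f s u) g c d If →
        HasKSIntegral M g c d Im → ‖If‖ ≤ Im)
    (hh_smooth : ContDiff ℝ 1 (Function.uncurry h))
    (φ : ℝ → ℝ → ℝ)
    (hφD : ∀ r : ℝ, 0 ≤ r → IsDFunction (fun t => φ t r))
    (hφlt : ∀ r : ℝ, 0 ≤ r → ∀ t : ℝ, 0 < t → φ t r < t)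
    (A3reg : ∀ v : En n, RegulatedOn (fun t => h t v) t₀ (t₀ + a))
    (A3lip : ∀ r : ℝ, 0 ≤ r → ∀ t ∈ Set.Icc t₀ (t₀ + a), ∀ u v : En n,
      ‖u‖ ≤ r → ‖v‖ ≤ r → ‖h t u - h t v‖ ≤ φ ‖u - v‖ r)
    (x₀ : En n) (x : ℝ → En n)
    (hx : IsHMDESolution h f g t₀ a x₀ x)
    (hinv : ∀ t ∈ Set.Icc t₀ (t₀ + a),
      Function.Bijective (ContinuousLinearMap.id ℝ (En n) - fderiv ℝ (h t) (x t))) :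
    (∀ t ∈ Set.Icc t₀ (t₀ + a), ∀ d : ℝ,
      HasDerivWithinAt g d (Set.Icc t₀ (t₀ + a)) t →
      ∃ x' : En n, HasDerivWithinAt x x' (Set.Icc t₀ (t₀ + a)) t ∧
        (ContinuousLinearMap.id ℝ (En n) - fderiv ℝ (h t) (x t)) x' =
          deriv (fun s => h s (x t)) t + d • f t (x t)) ∧
    (∀ t ∈ Set.Icc t₀ (t₀ + a), ∀ U ∈ nhdsWithin t (Set.Icc t₀ (t₀ + a)), ∀ g' : ℝ → ℝ,
      (∀ s ∈ U, HasDerivWithinAt g (g' s) (Set.Icc t₀ (t₀ + a)) s) →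
      ContinuousWithinAt g' U t →
      ∃ x' : ℝ → En n,
        (∀ s ∈ U, HasDerivWithinAt x (x' s) (Set.Icc t₀ (t₀ + a)) s) ∧
        ContinuousWithinAt x' U t) := by
  obtain ⟨hxreg, -, -, I, hI, hxeq⟩ := hx
  set J := Icc t₀ (t₀ + a)
  set H' : ℝ → ℝ × En n →L[ℝ] En n := fun s => fderiv ℝ (Function.uncurry h) (s, x s)
  set B : ℝ → En n →L[ℝ] En n := fun s => .id ℝ (En n) - (H' s).comp (.inr ℝ ℝ (En n))
  have hH : ∀ s, HasFDerivAt (Function.uncurry h) (H' s) (s, x s) := fun s =>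
    (hh_smooth.differentiable one_ne_zero _).hasFDerivAt
  have hB : ∀ s, ContinuousLinearMap.id ℝ (En n) - fderiv ℝ (h s) (x s) = B s := fun s => by
    have h₁ : HasFDerivAt (h s) ((H' s).comp (.inr ℝ ℝ (En n))) (x s) :=
      (hH s).comp (x s) (hasFDerivAt_prodMk_right s (x s))
    rw [h₁.fderiv]
  have hderiv : ∀ s, deriv (fun r => h r (x s)) s = H' s (1, 0) := fun s => by
    have h₁ : HasFDerivAt (fun r => h r (x s)) ((H' s).comp (.inl ℝ ℝ (En n))) s :=
      HasFDerivAt.comp (g := Function.uncurry h) (f := fun r => (r, x s)) s (hH s)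
        (hasFDerivAt_prodMk_left s (x s))
    simpa using h₁.hasDerivAt.deriv
  have hBinv : ∀ s ∈ J, ∃ e : En n ≃L[ℝ] En n, (e : En n →L[ℝ] En n) = B s := fun s hs => by
    have hbij := hinv s hs
    rw [hB s] at hbij
    exact ⟨.ofBijective (B s) (LinearMap.ker_eq_bot.2 hbij.1) (LinearMap.range_eq_top.2 hbij.2),
      ContinuousLinearEquiv.coe_ofBijective _ _ _⟩
  have hxcont : ContinuousOn x J := fun s hs => by
    obtain ⟨K, hK⟩ := (hxreg.comp_continuous hf_cont).eventually_norm_le hs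
    exact continuousWithinAt_of_regulatedOn_of_contraction hh_smooth.continuous hφlt A3lip
      hxreg hs (continuousWithinAt_indefinite hg_mono hI hs (hg_cont s hs) hK) hxeq
  have hpair : ContinuousOn (fun s => (s, x s)) J := continuousOn_id.prodMk hxcont
  have hfx : ContinuousOn (fun s => f s (x s)) J := hf_cont.comp_continuousOn hpair
  have hH' : ContinuousOn H' J :=
    (hh_smooth.continuous_fderiv one_ne_zero).comp_continuousOn hpair
  have main : ∀ s ∈ J, ∀ d : ℝ, HasDerivWithinAt g d J s →
      HasDerivWithinAt x ((B s).inverse (H' s (1, 0) + d • f s (x s))) J s := by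
    intro s hs d hd
    obtain ⟨e, he⟩ := hBinv s hs
    rw [← he, ContinuousLinearMap.inverse_equiv]
    exact hasDerivWithinAt_of_implicit (hH s) (hxcont s hs)
      (hasDerivWithinAt_indefinite hg_mono hI hs hd (hfx s hs)) hs hxeq e he
  refine ⟨fun t ht d hd => ⟨_, main t ht d hd, ?_⟩, fun t ht U hU g' hg' hg'c => ?_⟩
  · obtain ⟨e, he⟩ := hBinv t ht
    rw [hB, hderiv, ← he, ContinuousLinearMap.inverse_equiv]
    exact e.apply_symm_apply _
  · classical
    set D : ℝ → En n := fun s => (B s).inverse (H' s (1, 0) + g' s • f s (x s))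
    have hD : ContinuousWithinAt D (U ∩ J) t := by
      obtain ⟨e, he⟩ := hBinv t ht
      have hH't : ContinuousWithinAt H' (U ∩ J) t := (hH' t ht).mono inter_subset_right
      have hBt : ContinuousWithinAt B (U ∩ J) t :=
        continuousWithinAt_const.sub (hH't.clm_comp continuousWithinAt_const)
      have hinvc : ContinuousAt ContinuousLinearMap.inverse (B t) :=
        he ▸ (contDiffAt_map_inverse (n := 0) e).continuousAt
      exact (hinvc.comp_continuousWithinAt hBt).clm_apply
        ((hH't.clm_apply continuousWithinAt_const).add
          ((hg'c.mono inter_subset_left).smul ((hfx t ht).mono inter_subset_right)))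
    refine ⟨fun s => if s ∈ J then D s else D t, fun s hs => ?_, ?_⟩
    · by_cases hsJ : s ∈ J
      · simpa only [if_pos hsJ] using main s hsJ _ (hg' s hs)
      · exact hasDerivWithinAt_iff_hasFDerivWithinAt.2
          (.of_notMem_closure (by rwa [isClosed_Icc.closure_eq]))
    · rw [← inter_union_sdiff U J]
      refine ContinuousWithinAt.union (hD.congr (fun s hs => if_pos hs.2) (if_pos ht)) ?_
      exact continuousWithinAt_const.congr (fun s hs => if_neg hs.2) (if_pos ht)

end HMDEPaper
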